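/- arXiv:2103.00986 — 9 statements merged into one kernel-verified Lean document; each statement's English description precedes it below -/
import Mathlib

section
/- Let a₁, a₂ > 0, μ > 1, and a₃ ≤ 0. Let V : ℝ → ℝ be differentiable with V(t) ≥ 0 for all t ≥ 0 and V′(t) ≤ −a₁·V(t)^(1+1/μ) − a₂·V(t)^(1−1/μ) + a₃ for all t ≥ 0. Then V(t) = 0 for every t ≥ μ·π/(2·√(a₁·a₂)). (Fixed-time convergence to the origin with settling time independent of V(0); case a₃ ≤ 0 of Lemma 1.) -/
/-- Along a positive solution of `v' ≤ -a₁ v ^ (1 + 1/μ) - a₂ v ^ (1 - 1/μ)`, the quantity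
`arctan (k v ^ (1/μ))` with `k ^ 2 = a₁ / a₂` decreases at rate at least `k a₂ / μ`. -/
lemma arctan_rpow_deriv_le {a₁ a₂ k μ v d : ℝ} (hk : 0 < k) (hka : k ^ 2 * a₂ = a₁)
    (hμ : 0 < μ) (hv : 0 < v)
    (hd : d ≤ -a₁ * v ^ (1 + 1 / μ) - a₂ * v ^ (1 - 1 / μ)) :
    1 / (1 + (k * v ^ (1 / μ)) ^ 2) * (k * (d * (1 / μ) * v ^ (1 / μ - 1))) ≤
      -(k * a₂ / μ) := by
  rw [Real.rpow_add hv, Real.rpow_sub hv, Real.rpow_one] at hd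
  rw [Real.rpow_sub hv, Real.rpow_one]
  have hx : 0 < v ^ (1 / μ) := Real.rpow_pos_of_pos hv _
  generalize v ^ (1 / μ) = x at hd hx ⊢
  calc 1 / (1 + (k * x) ^ 2) * (k * (d * (1 / μ) * (x / v)))
      = k * x / (μ * v * (1 + (k * x) ^ 2)) * d := by field_simp
    _ ≤ k * x / (μ * v * (1 + (k * x) ^ 2)) * (-a₁ * (v * x) - a₂ * (v / x)) := by gcongr
    _ = -(k * a₂ / μ) := by
      have : 1 + (k * x) ^ 2 ≠ 0 := by positivity
      subst hka
      field_simp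
      ring


/-- Lemma 1, case `a₃ ≤ 0`: fixed-time convergence to the origin with settling time
`μ·π/(2·√(a₁·a₂))`, independent of the initial condition `V(0)`. -/
theorem stmt_0 (a₁ a₂ a₃ μ : ℝ) (ha₁ : 0 < a₁) (ha₂ : 0 < a₂) (hμ : 1 < μ)
    (ha₃ : a₃ ≤ 0) (V : ℝ → ℝ) (hV : Differentiable ℝ V)
    (hVnonneg : ∀ t, 0 ≤ t → 0 ≤ V t)
    (hVineq : ∀ t, 0 ≤ t →
      deriv V t ≤ -a₁ * V t ^ (1 + 1 / μ) - a₂ * V t ^ (1 - 1 / μ) + a₃) :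
    ∀ t, μ * Real.pi / (2 * Real.sqrt (a₁ * a₂)) ≤ t → V t = 0 := by
  intro t ht
  have hμ0 : 0 < μ := one_pos.trans hμ
  have hT : 0 ≤ t := le_trans (by positivity) ht
  have hanti : AntitoneOn V (Set.Ici 0) := by
    refine antitoneOn_of_deriv_nonpos (convex_Ici 0) hV.continuous.continuousOn
      hV.differentiableOn fun s hs => ?_
    rw [interior_Ici] at hs
    have hs : 0 ≤ s := (Set.mem_Ioi.1 hs).le
    have h₁ := mul_nonneg ha₁.le (Real.rpow_nonneg (hVnonneg s hs) (1 + 1 / μ))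
    have h₂ := mul_nonneg ha₂.le (Real.rpow_nonneg (hVnonneg s hs) (1 - 1 / μ))
    linarith [hVineq s hs]
  by_contra hne
  have hVt : 0 < V t := (hVnonneg t hT).lt_of_ne' hne
  have hpos : ∀ s ∈ Set.Icc 0 t, 0 < V s := fun s hs => hVt.trans_le (hanti hs.1 hT hs.2)
  set k := Real.sqrt (a₁ / a₂)
  have hk : 0 < k := Real.sqrt_pos.2 (div_pos ha₁ ha₂)
  have hka : k ^ 2 * a₂ = a₁ := by
    rw [Real.sq_sqrt (div_pos ha₁ ha₂).le, div_mul_cancel₀ _ ha₂.ne']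
  have hsqrt : Real.sqrt (a₁ * a₂) = k * a₂ := by
    rw [← hka, show k ^ 2 * a₂ * a₂ = (k * a₂) ^ 2 by ring, Real.sqrt_sq (by positivity)]
  have hderiv : ∀ s ∈ Set.Icc 0 t, HasDerivAt (fun s => Real.arctan (k * V s ^ (1 / μ)))
      (1 / (1 + (k * V s ^ (1 / μ)) ^ 2) *
        (k * (deriv V s * (1 / μ) * V s ^ (1 / μ - 1)))) s := fun s hs =>
    (((hV s).hasDerivAt.rpow_const (Or.inl (hpos s hs).ne')).const_mul k).arctan
  have hdecay := (convex_Icc 0 t).image_sub_le_mul_sub_of_deriv_le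
    (C := -(k * a₂ / μ))
    (fun s hs => (hderiv s hs).continuousAt.continuousWithinAt)
    (fun s hs => (hderiv s (interior_subset hs)).differentiableAt.differentiableWithinAt)
    (fun s hs => by
      have hs := interior_subset hs
      rw [(hderiv s hs).deriv]
      exact arctan_rpow_deriv_le hk hka hμ0 (hpos s hs) (by linarith [hVineq s hs.1]))
    0 (Set.left_mem_Icc.2 hT) t (Set.right_mem_Icc.2 hT) hT
  have hend : 0 < Real.arctan (k * V t ^ (1 / μ)) :=
    Real.arctan_pos.2 (mul_pos hk (Real.rpow_pos_of_pos hVt _))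
  have hstart := Real.arctan_lt_pi_div_two (k * V 0 ^ (1 / μ))
  have htime : Real.pi / 2 ≤ k * a₂ / μ * t := by
    rw [hsqrt, div_le_iff₀ (by positivity)] at ht
    rw [div_mul_eq_mul_div, le_div_iff₀ hμ0]
    linarith
  linarith
end

section
/- Let a₁, a₂ > 0, μ > 1, and 0 ≤ a₃ < 2·√(a₁·a₂). Set k₁ = √(4·a₁·a₂ − a₃²)/(2·a₁) and k₂ = −a₃/√(4·a₁·a₂ − a₃²). Let V : ℝ → ℝ be differentiable with V(t) ≥ 0 for all t ≥ 0 and V′(t) ≤ −a₁·V(t)^(1+1/μ) − a₂·V(t)^(1−1/μ) + a₃ for all t ≥ 0. Then V(t) ≤ 1 for every t ≥ (μ/(a₁·k₁))·(π/2 − arctan(k₂)). (The settling-time bound of Lemma 1, case 0 ≤ a₃ < 2√(a₁a₂), uniform over all initial conditions V(0).) -/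
/-- A differentiable function whose derivative is negative wherever it takes the value `c` on
`[0, ∞)` cannot leave `(-∞, c]` once it has entered it. -/
lemma le_of_le_of_deriv_neg_on_level {V : ℝ → ℝ} {c s t : ℝ} (hV : Differentiable ℝ V)
    (hs : 0 ≤ s) (hst : s ≤ t) (hVs : V s ≤ c)
    (hlevel : ∀ x, 0 ≤ x → V x = c → deriv V x < 0) : V t ≤ c :=
  image_le_of_deriv_right_lt_deriv_boundary (f' := deriv V) (B := fun _ => c) (B' := fun _ => 0)
    hV.continuous.continuousOn (fun x _ => (hV x).hasDerivAt.hasDerivWithinAt) hVs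
    (fun x => hasDerivAt_const x c) (fun x hx h => hlevel x (hs.trans hx.1) h) ⟨hst, le_rfl⟩

/-- The fixed-time inequality at a point where `v ≥ 1`, divided by the power `v ^ (1 - p)`. -/
lemma rpow_mul_le_neg_quadratic {a₁ a₂ a₃ p v d : ℝ} (ha₃ : 0 ≤ a₃) (hv : 1 ≤ v)
    (hd : d ≤ -a₁ * v ^ (1 + p) - a₂ * v ^ (1 - p) + a₃) :
    v ^ (p - 1) * d ≤ -(a₁ * (v ^ p) ^ 2 - a₃ * v ^ p + a₂) := by
  have hv0 : 0 < v := by linarith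
  have h₁ : v ^ (p - 1) * v ^ (1 + p) = (v ^ p) ^ 2 := by
    rw [sq, ← Real.rpow_add hv0, ← Real.rpow_add hv0]
    ring_nf
  have h₂ : v ^ (p - 1) * v ^ (1 - p) = 1 := by
    rw [← Real.rpow_add hv0]
    simp
  have h₃ : v ^ (p - 1) ≤ v ^ p := Real.rpow_le_rpow_of_exponent_le hv (by linarith)
  calc v ^ (p - 1) * d
      ≤ v ^ (p - 1) * (-a₁ * v ^ (1 + p) - a₂ * v ^ (1 - p) + a₃) := by gcongr
    _ = -a₁ * (v ^ (p - 1) * v ^ (1 + p)) - a₂ * (v ^ (p - 1) * v ^ (1 - p))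
          + a₃ * v ^ (p - 1) := by ring
    _ ≤ -a₁ * (v ^ (p - 1) * v ^ (1 + p)) - a₂ * (v ^ (p - 1) * v ^ (1 - p))
          + a₃ * v ^ p := by gcongr
    _ = -(a₁ * (v ^ p) ^ 2 - a₃ * v ^ p + a₂) := by rw [h₁, h₂]; ring

/-- Along a trajectory above `1`, the arctangent of the normalised variable decreases at least
at the constant rate `p * D / 2`, where `D ^ 2 = 4 * a₁ * a₂ - a₃ ^ 2`. -/
lemma arctan_rpow_le_sub {a₁ a₂ a₃ p D t : ℝ} {V : ℝ → ℝ} (ha₁ : 0 < a₁) (ha₃ : 0 ≤ a₃)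
    (hp : 0 < p) (hD : 0 < D) (hDsq : D ^ 2 = 4 * a₁ * a₂ - a₃ ^ 2)
    (hV : Differentiable ℝ V) (ht : 0 ≤ t) (hV1 : ∀ s ∈ Set.Icc 0 t, 1 < V s)
    (hVineq : ∀ s ∈ Set.Icc 0 t,
      deriv V s ≤ -a₁ * V s ^ (1 + p) - a₂ * V s ^ (1 - p) + a₃) :
    Real.arctan ((2 * a₁ * V t ^ p - a₃) / D) ≤
      Real.arctan ((2 * a₁ * V 0 ^ p - a₃) / D) - p * D / 2 * t := by
  set g : ℝ → ℝ := fun s => Real.arctan ((2 * a₁ * V s ^ p - a₃) / D) + p * D / 2 * s with hg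
  have hderiv : ∀ s ∈ Set.Icc 0 t, HasDerivAt g
      (1 / (1 + ((2 * a₁ * V s ^ p - a₃) / D) ^ 2) *
        (2 * a₁ * (deriv V s * p * V s ^ (p - 1)) / D) + p * D / 2 * 1) s := fun s hs =>
    (((((hV s).hasDerivAt.rpow_const (Or.inl (by linarith [hV1 s hs]))).const_mul
      (2 * a₁)).sub_const a₃).div_const D).arctan.add ((hasDerivAt_id s).const_mul (p * D / 2))
  have hanti : AntitoneOn g (Set.Icc 0 t) := by
    refine antitoneOn_of_deriv_nonpos (convex_Icc 0 t)
      (fun s hs => (hderiv s hs).continuousAt.continuousWithinAt)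
      (fun s hs => (hderiv s (interior_subset hs)).differentiableAt.differentiableWithinAt)
      fun s hs => ?_
    replace hs := interior_subset hs
    rw [(hderiv s hs).deriv]
    have hquad := rpow_mul_le_neg_quadratic ha₃ (hV1 s hs).le (hVineq s hs)
    set W := V s ^ p
    set u := (2 * a₁ * W - a₃) / D
    have hsq : 4 * a₁ * (a₁ * W ^ 2 - a₃ * W + a₂) = D ^ 2 * (1 + u ^ 2) := by
      have hDu : D * u = 2 * a₁ * W - a₃ := mul_div_cancel₀ _ hD.ne'
      rw [mul_add (D ^ 2), ← mul_pow, hDu, hDsq]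
      ring
    have hnum : 2 * a₁ * (deriv V s * p * V s ^ (p - 1)) / D ≤ -(p * D / 2) * (1 + u ^ 2) := by
      rw [div_le_iff₀ hD]
      nlinarith [mul_le_mul_of_nonneg_left hquad (by positivity : 0 ≤ 2 * a₁ * p)]
    have hpos : 0 < 1 + u ^ 2 := by positivity
    rw [one_div_mul_eq_div, mul_one]
    linarith [(div_le_iff₀ hpos).2 hnum]
  have := hanti ⟨le_rfl, ht⟩ ⟨ht, le_rfl⟩ ht
  simp only [hg, mul_zero, add_zero] at this
  linarith

/-- Lemma 1, settling-time bound in the case `0 ≤ a₃ < 2√(a₁a₂)`: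
the trajectory satisfies `V(t) ≤ 1` after the fixed time
`(μ/(a₁·k₁))·(π/2 − arctan k₂)`, uniformly over all initial conditions. -/
theorem stmt_1 (a₁ a₂ a₃ μ k₁ k₂ : ℝ) (ha₁ : 0 < a₁) (ha₂ : 0 < a₂) (hμ : 1 < μ)
    (ha₃0 : 0 ≤ a₃) (ha₃ : a₃ < 2 * Real.sqrt (a₁ * a₂))
    (hk₁ : k₁ = Real.sqrt (4 * a₁ * a₂ - a₃ ^ 2) / (2 * a₁))
    (hk₂ : k₂ = -a₃ / Real.sqrt (4 * a₁ * a₂ - a₃ ^ 2))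
    (V : ℝ → ℝ) (hV : Differentiable ℝ V)
    (hVnonneg : ∀ t, 0 ≤ t → 0 ≤ V t)
    (hVineq : ∀ t, 0 ≤ t →
      deriv V t ≤ -a₁ * V t ^ (1 + 1 / μ) - a₂ * V t ^ (1 - 1 / μ) + a₃) :
    ∀ t, (μ / (a₁ * k₁)) * (Real.pi / 2 - Real.arctan k₂) ≤ t → V t ≤ 1 := by
  intro t ht
  have hsqrt : Real.sqrt (a₁ * a₂) ^ 2 = a₁ * a₂ := Real.sq_sqrt (by positivity)
  have hdisc : 0 < 4 * a₁ * a₂ - a₃ ^ 2 := by nlinarith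
  have ha₃' : a₃ < a₁ + a₂ := by nlinarith [sq_nonneg (a₁ - a₂)]
  have hDpos := Real.sqrt_pos.2 hdisc
  have hDsq := Real.sq_sqrt hdisc.le
  set D := Real.sqrt (4 * a₁ * a₂ - a₃ ^ 2)
  have hμ0 : 0 < μ := by linarith
  have hrate : μ / (a₁ * k₁) = (1 / μ * D / 2)⁻¹ := by
    rw [hk₁]
    field_simp
  have hrate_pos : 0 < 1 / μ * D / 2 := by positivity
  rw [hrate, inv_mul_le_iff₀ hrate_pos] at ht
  have ht0 : 0 ≤ t :=
    (pos_of_mul_pos_right (by linarith [Real.arctan_lt_pi_div_two k₂]) hrate_pos.le).le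
  by_contra! hVt
  have hV1 : ∀ s ∈ Set.Icc 0 t, 1 < V s := by
    intro s hs
    by_contra! hVs
    refine hVt.not_ge (le_of_le_of_deriv_neg_on_level hV hs.1 hs.2 hVs fun x hx hVx => ?_)
    have := hVineq x hx
    simp only [hVx, Real.one_rpow] at this
    linarith
  have hle := arctan_rpow_le_sub ha₁ ha₃0 (one_div_pos.2 hμ0) hDpos hDsq hV ht0 hV1
    fun s hs => hVineq s hs.1
  have hlt : Real.arctan ((2 * a₁ * V t ^ (1 / μ) - a₃) / D) < Real.arctan k₂ := by
    linarith [Real.arctan_lt_pi_div_two ((2 * a₁ * V 0 ^ (1 / μ) - a₃) / D)]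
  rw [Real.arctan_strictMono.lt_iff_lt, hk₂, div_lt_div_iff_of_pos_right hDpos] at hlt
  have : 0 ≤ 2 * a₁ * V t ^ (1 / μ) := by
    have := hVnonneg t ht0
    positivity
  linarith
end

section
/- Let a₁, a₂ > 0, μ > 1, and a₃ ≥ 0. Let V : ℝ → ℝ be differentiable with V(t) ≥ 0 for all t ≥ 0 and V′(t) ≤ −a₁·V(t)^(1+1/μ) − a₂·V(t)^(1−1/μ) + a₃ for all t ≥ 0. If V(t₀) ≤ a₃/(2·√(a₁·a₂)) for some t₀ ≥ 0, then V(t) ≤ a₃/(2·√(a₁·a₂)) for all t ≥ t₀. (Forward invariance of the residual set D = {V ≤ a₃/(2√(a₁a₂))} from Lemma 1.) -/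
/-- AM-GM for two powers of `x` with exponents symmetric about `1`. -/
lemma two_mul_sqrt_mul_le_rpow_add_rpow {a b x : ℝ} (ha : 0 ≤ a) (hb : 0 ≤ b) (hx : 0 < x)
    (s : ℝ) : 2 * √(a * b) * x ≤ a * x ^ (1 + s) + b * x ^ (1 - s) := by
  have hadd : x ^ (1 + s) = (x ^ ((1 + s) / 2)) ^ 2 := by
    rw [← Real.rpow_mul_natCast hx.le]
    congr 1
    push_cast
    ring
  have hsub : x ^ (1 - s) = (x ^ ((1 - s) / 2)) ^ 2 := by
    rw [← Real.rpow_mul_natCast hx.le]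
    congr 1
    push_cast
    ring
  have hmul : x ^ ((1 + s) / 2) * x ^ ((1 - s) / 2) = x := by
    rw [← Real.rpow_add hx, show (1 + s) / 2 + (1 - s) / 2 = 1 by ring, Real.rpow_one]
  rw [hadd, hsub, Real.sqrt_mul ha]
  calc 2 * (√a * √b) * x
      = 2 * (√a * x ^ ((1 + s) / 2)) * (√b * x ^ ((1 - s) / 2)) := by
        linear_combination -2 * √a * √b * hmul
    _ ≤ (√a * x ^ ((1 + s) / 2)) ^ 2 + (√b * x ^ ((1 - s) / 2)) ^ 2 := two_mul_le_add_sq _ _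
    _ = _ := by rw [mul_pow, mul_pow, Real.sq_sqrt ha, Real.sq_sqrt hb]

/-- A sublevel set is forward invariant if the derivative is negative at all values above it. -/
lemma le_of_deriv_neg_of_lt {f : ℝ → ℝ} (hf : Differentiable ℝ f) {c t₀ : ℝ} (h₀ : f t₀ ≤ c)
    (hneg : ∀ t, t₀ ≤ t → c < f t → deriv f t < 0) {t : ℝ} (ht : t₀ ≤ t) : f t ≤ c := by
  refine le_of_forall_pos_le_add fun ε hε => ?_
  refine image_le_of_deriv_right_lt_deriv_boundary (f := f) (f' := deriv f)
    (B := fun _ => c + ε) (B' := fun _ => 0) hf.continuous.continuousOn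
    (fun x _ => (hf x).hasDerivAt.hasDerivWithinAt) (by linarith)
    (fun x => hasDerivAt_const x _) (fun x hx hfx => hneg x hx.1 ?_) ⟨ht, le_rfl⟩
  linarith

/-- Lemma 1: forward invariance of the residual set `D = {V ≤ a₃/(2√(a₁a₂))}`. -/
theorem stmt_2 (a₁ a₂ a₃ μ : ℝ) (ha₁ : 0 < a₁) (ha₂ : 0 < a₂) (hμ : 1 < μ)
    (ha₃ : 0 ≤ a₃) (V : ℝ → ℝ) (hV : Differentiable ℝ V)
    (hVnonneg : ∀ t, 0 ≤ t → 0 ≤ V t)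
    (hVineq : ∀ t, 0 ≤ t →
      deriv V t ≤ -a₁ * V t ^ (1 + 1 / μ) - a₂ * V t ^ (1 - 1 / μ) + a₃)
    (t₀ : ℝ) (ht₀ : 0 ≤ t₀) (h₀ : V t₀ ≤ a₃ / (2 * Real.sqrt (a₁ * a₂))) :
    ∀ t, t₀ ≤ t → V t ≤ a₃ / (2 * Real.sqrt (a₁ * a₂)) := by
  have hs : 0 < 2 * Real.sqrt (a₁ * a₂) := by positivity
  intro t ht
  refine le_of_deriv_neg_of_lt hV h₀ (fun x hx hlt => ?_) ht
  have hVx : 0 < V x := lt_of_le_of_lt (by positivity) hlt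
  have hamgm := two_mul_sqrt_mul_le_rpow_add_rpow ha₁.le ha₂.le hVx (1 / μ)
  rw [div_lt_iff₀ hs] at hlt
  linarith [hVineq x (ht₀.trans hx)]
end

section
/- Let a₁, a₂ > 0, μ > 1, and 0 ≤ a₃ < 2·√(a₁·a₂). For every ε > a₃/(2·√(a₁·a₂)) there exists a time T ≥ 0, depending only on a₁, a₂, a₃, μ and ε, such that: for every differentiable V : ℝ → ℝ with V(t) ≥ 0 for all t ≥ 0 and V′(t) ≤ −a₁·V(t)^(1+1/μ) − a₂·V(t)^(1−1/μ) + a₃ for all t ≥ 0, one has V(t) ≤ ε for all t ≥ T. (Fixed-time convergence to every neighborhood of the residual set {V ≤ a₃/(2√(a₁a₂))}, with convergence time independent of the initial condition; Lemma 1.) -/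
theorem two_mul_sqrt_le_add_mul {a b p q : ℝ} (ha : 0 ≤ a) (hb : 0 ≤ b) (hp : 0 ≤ p) (hq : 0 ≤ q)
    (hpq : p * q = 1) : 2 * Real.sqrt (a * b) ≤ a * p + b * q := by
  have hs := Real.sq_sqrt (mul_nonneg ha hb)
  refine abs_le_of_sq_le_sq' ?_ (by positivity) |>.2
  have h : a * p * (b * q) = a * b := by linear_combination a * b * hpq
  nlinarith [sq_nonneg (a * p - b * q)]

/-- Above the level `ε`, the constant `a₃` absorbs at most the fraction `a₃ / (2√(a₁a₂) ε)` of the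
dissipation. -/
theorem neg_rpow_sub_rpow_add_le {a₁ a₂ a₃ r ε x : ℝ} (ha₁ : 0 < a₁) (ha₂ : 0 < a₂)
    (ha₃ : 0 ≤ a₃) (hε : 0 < ε) (hθ : a₃ / (2 * Real.sqrt (a₁ * a₂) * ε) ≤ 1) (hx : ε ≤ x) :
    -a₁ * x ^ (1 + r) - a₂ * x ^ (1 - r) + a₃ ≤
      -((1 - a₃ / (2 * Real.sqrt (a₁ * a₂) * ε)) * a₁) * x ^ (1 + r) := by
  have hx0 : 0 < x := hε.trans_le hx
  have hs : 0 < 2 * Real.sqrt (a₁ * a₂) := by positivity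
  have hp : 0 < x ^ r := Real.rpow_pos_of_pos hx0 r
  have hq : 0 < x ^ (-r) := Real.rpow_pos_of_pos hx0 (-r)
  have hpq : x ^ r * x ^ (-r) = 1 := by rw [← Real.rpow_add hx0]; simp
  have key := two_mul_sqrt_le_add_mul ha₁.le ha₂.le hp.le hq.le hpq
  rw [sub_eq_add_neg 1 r, Real.rpow_add hx0, Real.rpow_add hx0, Real.rpow_one]
  set s := 2 * Real.sqrt (a₁ * a₂)
  set θ := a₃ / (s * ε) with hθ_def
  have hθ0 : 0 ≤ θ := by positivity
  have h₃ : a₃ = θ * (s * ε) := by rw [hθ_def]; field_simp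
  have h₄ : s * ε ≤ (a₁ * x ^ r + a₂ * x ^ (-r)) * x :=
    mul_le_mul key hx hε.le (hs.le.trans key)
  have h₅ := mul_le_mul_of_nonneg_left h₄ hθ0
  have h₆ : 0 ≤ (1 - θ) * (a₂ * x ^ (-r) * x) :=
    mul_nonneg (sub_nonneg.2 hθ) (by positivity)
  linarith

/-- Comparison principle for `V' ≤ -c V ^ (1 + r)` above a level `ε`: the time needed to reach the
level does not depend on the initial value. -/
theorem exists_le_of_deriv_le_neg_rpow {c r ε : ℝ} (hc : 0 < c) (hr : 0 < r) (hε : 0 < ε)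
    {V : ℝ → ℝ} (hV : Differentiable ℝ V)
    (h : ∀ t, 0 ≤ t → ε ≤ V t → deriv V t ≤ -c * V t ^ (1 + r)) :
    ∃ t ∈ Set.Icc 0 (ε ^ (-r) / (r * c)), V t ≤ ε := by
  set T := ε ^ (-r) / (r * c) with hT
  have hT0 : 0 ≤ T := by positivity
  by_contra! hlt
  have hpos : ∀ t ∈ Set.Icc 0 T, 0 < V t := fun t ht => hε.trans (hlt t ht)
  have hder : ∀ t ∈ Set.Icc 0 T,
      HasDerivAt (fun t => V t ^ (-r)) (deriv V t * (-r) * V t ^ (-r - 1)) t := fun t ht =>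
    (hV t).hasDerivAt.rpow_const (Or.inl (hpos t ht).ne')
  have hle := (convex_Icc 0 T).mul_sub_le_image_sub_of_le_deriv (f := fun t => V t ^ (-r))
    (C := r * c) (fun t ht => (hder t ht).continuousAt.continuousWithinAt)
    (fun t ht => (hder t (interior_subset ht)).differentiableAt.differentiableWithinAt)
    (fun t ht => by
      have ht' := interior_subset ht
      rw [(hder t ht').deriv]
      have hVt := h t ht'.1 (hlt t ht').le
      have hq : 0 < V t ^ (-r - 1) := Real.rpow_pos_of_pos (hpos t ht') _
      have hpq : V t ^ (1 + r) * V t ^ (-r - 1) = 1 := by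
        rw [← Real.rpow_add (hpos t ht'), show 1 + r + (-r - 1) = 0 by ring, Real.rpow_zero]
      have hmul := mul_le_mul_of_nonneg_left hVt (mul_pos hr hq).le
      linear_combination hmul - r * c * hpq)
    0 (Set.left_mem_Icc.2 hT0) T (Set.right_mem_Icc.2 hT0) hT0
  have hcT : r * c * (T - 0) = ε ^ (-r) := by rw [hT]; field_simp; ring
  have h₀ : 0 < V 0 ^ (-r) := Real.rpow_pos_of_pos (hpos 0 (Set.left_mem_Icc.2 hT0)) _
  have h₁ : V T ^ (-r) ≤ ε ^ (-r) :=
    Real.rpow_le_rpow_of_nonpos hε (hlt T (Set.right_mem_Icc.2 hT0)).le (by linarith)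
  linarith

/-- Sublevel sets on whose boundary the derivative is negative are forward invariant. -/
theorem le_of_le_of_deriv_neg {V : ℝ → ℝ} (hV : Differentiable ℝ V) {ε a t : ℝ} (hat : a ≤ t)
    (ha : V a ≤ ε) (h : ∀ s, a ≤ s → V s = ε → deriv V s < 0) : V t ≤ ε :=
  image_le_of_deriv_right_lt_deriv_boundary (f' := deriv V) (B := fun _ => ε) (B' := fun _ => 0)
    hV.continuous.continuousOn (fun s _ => (hV s).hasDerivAt.hasDerivWithinAt) ha
    (fun s => hasDerivAt_const s ε) (fun s hs => h s hs.1) (Set.right_mem_Icc.2 hat)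


/-- Lemma 1, case `0 ≤ a₃ < 2√(a₁a₂)`: fixed-time convergence to every neighborhood
of the residual set `{V ≤ a₃/(2√(a₁a₂))}` with convergence time `T` depending only on
`a₁, a₂, a₃, μ, ε` and independent of the initial condition. -/
theorem stmt_3 (a₁ a₂ a₃ μ : ℝ) (ha₁ : 0 < a₁) (ha₂ : 0 < a₂) (hμ : 1 < μ)
    (ha₃0 : 0 ≤ a₃) (ha₃ : a₃ < 2 * Real.sqrt (a₁ * a₂)) :
    ∀ ε : ℝ, a₃ / (2 * Real.sqrt (a₁ * a₂)) < ε →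
      ∃ T : ℝ, 0 ≤ T ∧
        ∀ V : ℝ → ℝ, Differentiable ℝ V →
          (∀ t, 0 ≤ t → 0 ≤ V t) →
          (∀ t, 0 ≤ t →
            deriv V t ≤ -a₁ * V t ^ (1 + 1 / μ) - a₂ * V t ^ (1 - 1 / μ) + a₃) →
          ∀ t, T ≤ t → V t ≤ ε := by
  intro ε hε
  have hs : 0 < 2 * Real.sqrt (a₁ * a₂) := by positivity
  have hε0 : 0 < ε := (div_nonneg ha₃0 hs.le).trans_lt hε
  have hr : 0 < 1 / μ := by positivity
  have hθ : a₃ / (2 * Real.sqrt (a₁ * a₂) * ε) < 1 := by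
    rw [← div_div, div_lt_one hε0]
    exact hε
  have hc : 0 < (1 - a₃ / (2 * Real.sqrt (a₁ * a₂) * ε)) * a₁ := mul_pos (sub_pos.2 hθ) ha₁
  refine ⟨ε ^ (-(1 / μ)) / (1 / μ * ((1 - a₃ / (2 * Real.sqrt (a₁ * a₂) * ε)) * a₁)),
    by positivity, fun V hV _ hdV t ht => ?_⟩
  have hdecay : ∀ t, 0 ≤ t → ε ≤ V t → deriv V t ≤
      -((1 - a₃ / (2 * Real.sqrt (a₁ * a₂) * ε)) * a₁) * V t ^ (1 + 1 / μ) := fun t ht hVt =>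
    (hdV t ht).trans (neg_rpow_sub_rpow_add_le ha₁ ha₂ ha₃0 hε0 hθ.le hVt)
  obtain ⟨t₀, ht₀, hVt₀⟩ := exists_le_of_deriv_le_neg_rpow hc hr hε0 hV hdecay
  refine le_of_le_of_deriv_neg hV (ht₀.2.trans ht) hVt₀ fun s hst hVs => ?_
  refine (hdecay s (ht₀.1.trans hst) hVs.ge).trans_lt ?_
  rw [hVs, neg_mul, neg_lt_zero]
  positivity
end

section
/- Let a₁, a₂ > 0, μ > 1, and a₃ be such that a₃ > 2·√(a₁·a₂) and a₃ ≥ a₁ + a₂. Let b = (a₃ − √(a₃² − 4·a₁·a₂))/(2·a₁) and c = (a₃ + √(a₃² − 4·a₁·a₂))/(2·a₁) be the roots of a₁·s² − a₃·s + a₂ = 0 (so 0 < b < 1 ≤ c). Let V : ℝ → ℝ be differentiable with V(t) ≥ 0 for all t ≥ 0 and V′(t) ≤ −a₁·V(t)^(1+1/μ) − a₂·V(t)^(1−1/μ) + a₃ for all t ≥ 0. Then for every ρ > c and every t ≥ (μ/(a₁·(c − b)))·log((ρ − b)/(ρ − c)), one has V(t) ≤ ρ^μ. (Settling-time bound of Lemma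 1 in the case a₃ > 2√(a₁a₂): fixed-time convergence, uniform over all initial conditions, to every neighborhood of the residual set {V ≤ c^μ}.) -/
/-- Where `1 ≤ c < V ^ (1 / μ)`, the constant perturbation is dominated by `a₃ * V`, and the
right-hand side factors through the roots of the quadratic. -/
theorem fixedTime_rhs_le {a₁ a₂ a₃ μ b c v : ℝ} (ha₃ : 0 ≤ a₃) (hv : 1 ≤ v)
    (hroots : ∀ s, a₁ * s ^ 2 - a₃ * s + a₂ = a₁ * (s - b) * (s - c)) :
    -a₁ * v ^ (1 + 1 / μ) - a₂ * v ^ (1 - 1 / μ) + a₃ ≤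
      -(v / v ^ (1 / μ)) * (a₁ * (v ^ (1 / μ) - b) * (v ^ (1 / μ) - c)) := by
  have hv0 : 0 < v := by linarith
  have hs : 0 < v ^ (1 / μ) := Real.rpow_pos_of_pos hv0 _
  rw [← hroots, Real.rpow_add hv0, Real.rpow_sub hv0, Real.rpow_one]
  have hexpand : -(v / v ^ (1 / μ)) * (a₁ * (v ^ (1 / μ)) ^ 2 - a₃ * v ^ (1 / μ) + a₂) =
      -a₁ * (v * v ^ (1 / μ)) - a₂ * (v / v ^ (1 / μ)) + a₃ * v := by
    field_simp
    ring
  rw [hexpand]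
  nlinarith

/-- The roots given by the quadratic formula factor the quadratic, and they satisfy
`b < c` and `1 ≤ c`. -/
theorem fixedTime_roots {a₁ a₂ a₃ b c : ℝ} (ha₁ : 0 < a₁) (ha₂ : 0 < a₂)
    (ha₃ : 2 * Real.sqrt (a₁ * a₂) < a₃) (ha₃' : a₁ + a₂ ≤ a₃)
    (hb : b = (a₃ - Real.sqrt (a₃ ^ 2 - 4 * a₁ * a₂)) / (2 * a₁))
    (hc : c = (a₃ + Real.sqrt (a₃ ^ 2 - 4 * a₁ * a₂)) / (2 * a₁)) :
    (∀ s, a₁ * s ^ 2 - a₃ * s + a₂ = a₁ * (s - b) * (s - c)) ∧ b < c ∧ 1 ≤ c := by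
  have hsq : Real.sqrt (a₁ * a₂) ^ 2 = a₁ * a₂ := Real.sq_sqrt (by positivity)
  have hdisc : 0 < a₃ ^ 2 - 4 * a₁ * a₂ := by
    nlinarith [Real.sqrt_nonneg (a₁ * a₂)]
  have hr2 := Real.sq_sqrt hdisc.le
  have hr := Real.sqrt_pos.2 hdisc
  set r := Real.sqrt (a₃ ^ 2 - 4 * a₁ * a₂)
  have hfac : ∀ s, a₁ * s ^ 2 - a₃ * s + a₂ = a₁ * (s - b) * (s - c) := by
    intro s
    rw [hb, hc]
    field_simp
    linear_combination hr2
  have hbc : b < c := by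
    rw [hb, hc]
    gcongr
    linarith
  refine ⟨hfac, hbc, ?_⟩
  by_contra! h
  have h1 := hfac 1
  have : 0 < a₁ * (1 - b) * (1 - c) :=
    mul_pos (mul_pos ha₁ (by linarith)) (by linarith)
  nlinarith


/-- Lemma 1, case `a₃ > 2√(a₁a₂)` (with `a₃ ≥ a₁ + a₂`): fixed-time convergence,
uniform in the initial condition, to every neighborhood of the residual set
`{V ≤ c^μ}`, with the logarithmic settling-time bound. -/
theorem stmt_5 (a₁ a₂ a₃ μ b c : ℝ) (ha₁ : 0 < a₁) (ha₂ : 0 < a₂) (hμ : 1 < μ)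
    (ha₃ : 2 * Real.sqrt (a₁ * a₂) < a₃) (ha₃' : a₁ + a₂ ≤ a₃)
    (hb : b = (a₃ - Real.sqrt (a₃ ^ 2 - 4 * a₁ * a₂)) / (2 * a₁))
    (hc : c = (a₃ + Real.sqrt (a₃ ^ 2 - 4 * a₁ * a₂)) / (2 * a₁))
    (V : ℝ → ℝ) (hV : Differentiable ℝ V)
    (hVnonneg : ∀ t, 0 ≤ t → 0 ≤ V t)
    (hVineq : ∀ t, 0 ≤ t →
      deriv V t ≤ -a₁ * V t ^ (1 + 1 / μ) - a₂ * V t ^ (1 - 1 / μ) + a₃) :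
    ∀ ρ : ℝ, c < ρ →
      ∀ t, (μ / (a₁ * (c - b))) * Real.log ((ρ - b) / (ρ - c)) ≤ t →
        V t ≤ ρ ^ μ := by
  intro ρ hρ t ht
  obtain ⟨hroots, hbc, hc1⟩ := fixedTime_roots ha₁ ha₂ ha₃ ha₃' hb hc
  have hμ0 : 0 < μ := by linarith
  have hk : 0 < a₁ * (c - b) / μ := div_pos (mul_pos ha₁ (by linarith)) hμ0
  have hlog : 0 < Real.log ((ρ - b) / (ρ - c)) := by
    apply Real.log_pos
    rw [one_lt_div (by linarith)]
    linarith
  have ht' : Real.log ((ρ - b) / (ρ - c)) ≤ a₁ * (c - b) / μ * t := by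
    rw [← div_le_iff₀' hk]
    refine le_trans (le_of_eq ?_) ht
    field_simp
  have ht0 : 0 ≤ t := by
    by_contra! h
    nlinarith
  have hK : 1 ≤ ρ ^ μ := Real.one_le_rpow (by linarith) hμ0.le
  have hρs : ∀ v, ρ ^ μ ≤ v → ρ ≤ v ^ (1 / μ) := by
    intro v hv
    rw [one_div, Real.le_rpow_inv_iff_of_pos (by linarith) (by linarith) hμ0]
    exact hv
  have hderiv : ∀ τ, 0 ≤ τ → ρ ^ μ ≤ V τ →
      deriv V τ ≤ -(V τ / V τ ^ (1 / μ)) *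
        (a₁ * (V τ ^ (1 / μ) - b) * (V τ ^ (1 / μ) - c)) := fun τ hτ h =>
    (hVineq τ hτ).trans (fixedTime_rhs_le (by linarith) (hK.trans h) hroots)
  by_contra! hlt
  have habove : ∀ τ ∈ Set.Icc 0 t, ρ ^ μ < V τ := by
    intro τ hτ
    by_contra! hle
    refine hlt.not_ge (image_le_of_deriv_right_lt_deriv_boundary (f' := deriv V) (B' := 0)
      (B := fun _ => ρ ^ μ) hV.continuous.continuousOn
      (fun x _ => (hV x).hasDerivAt.hasDerivWithinAt) hle
      (fun x => hasDerivAt_const x _) ?_ (Set.right_mem_Icc.2 hτ.2))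
    intro x hx hVx
    have hs := hρs (V x) hVx.ge
    have hVpos : 0 < V x := by linarith
    refine (hderiv x (hτ.1.trans hx.1) hVx.ge).trans_lt ?_
    rw [neg_mul, Pi.zero_apply, neg_lt_zero]
    exact mul_pos (div_pos hVpos (by linarith))
      (mul_pos (mul_pos ha₁ (by linarith)) (by linarith))
  set G : ℝ → ℝ := fun τ => Real.log (V τ ^ (1 / μ) - b) - Real.log (V τ ^ (1 / μ) - c)
    with hG
  have hGderiv : ∀ τ ∈ Set.Icc 0 t, ∃ g, HasDerivAt G g τ ∧ a₁ * (c - b) / μ ≤ g := by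
    intro τ hτ
    have hVτ := habove τ hτ
    have hs := hρs (V τ) hVτ.le
    have hVpos : 0 < V τ := by linarith
    have hsd := (hV τ).hasDerivAt.rpow_const (p := 1 / μ) (Or.inl hVpos.ne')
    have hsb : 0 < V τ ^ (1 / μ) - b := by linarith
    have hsc : 0 < V τ ^ (1 / μ) - c := by linarith
    refine ⟨_, ((hsd.sub_const b).log hsb.ne').sub ((hsd.sub_const c).log hsc.ne'), ?_⟩
    have hd := hderiv τ hτ.1 hVτ.le
    rw [Real.rpow_sub hVpos, Real.rpow_one]
    set s := V τ ^ (1 / μ)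
    have hs0 : 0 < s := by linarith
    have hcoef : 0 ≤ (s / V τ) * (c - b) / (μ * ((s - b) * (s - c))) :=
      div_nonneg (mul_nonneg (by positivity) (by linarith)) (by positivity)
    have hmul := mul_le_mul_of_nonneg_left hd hcoef
    have hleft : (s / V τ) * (c - b) / (μ * ((s - b) * (s - c))) *
        (-(V τ / s) * (a₁ * (s - b) * (s - c))) = -(a₁ * (c - b) / μ) := by
      field_simp
    have hright : deriv V τ * (1 / μ) * (s / V τ) / (s - b) -
        deriv V τ * (1 / μ) * (s / V τ) / (s - c) =
        -((s / V τ) * (c - b) / (μ * ((s - b) * (s - c))) * deriv V τ) := by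
      field_simp
      ring
    rw [hright]
    linarith
  have hgrowth : a₁ * (c - b) / μ * (t - 0) ≤ G t - G 0 := by
    refine (convex_Icc 0 t).mul_sub_le_image_sub_of_le_deriv ?_ ?_ ?_ 0
      (Set.left_mem_Icc.2 ht0) t (Set.right_mem_Icc.2 ht0) ht0
    · intro τ hτ
      obtain ⟨g, hg, -⟩ := hGderiv τ hτ
      exact hg.continuousAt.continuousWithinAt
    · intro τ hτ
      obtain ⟨g, hg, -⟩ := hGderiv τ (interior_subset hτ)
      exact hg.differentiableAt.differentiableWithinAt
    · intro τ hτ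
      obtain ⟨g, hg, hle⟩ := hGderiv τ (interior_subset hτ)
      rwa [hg.deriv]
  have hG0 : 0 < G 0 := by
    have hs := hρs (V 0) (habove 0 (Set.left_mem_Icc.2 ht0)).le
    exact sub_pos.2 (Real.log_lt_log (by linarith) (by linarith))
  have hGt : G t ≤ Real.log ((ρ - b) / (ρ - c)) := by
    have hs := hρs (V t) hlt.le
    have hsc : 0 < V t ^ (1 / μ) - c := by linarith
    have hsb : 0 < V t ^ (1 / μ) - b := by linarith
    rw [hG]
    beta_reduce
    rw [← Real.log_div hsb.ne' hsc.ne']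
    apply Real.log_le_log (div_pos hsb hsc)
    rw [div_le_div_iff₀ hsc (by linarith)]
    nlinarith
  linarith
end

section
/- Let a₁, a₂ > 0, μ > 1, and a₃ = 2·√(a₁·a₂). Let k > 1 be such that k·√(a₂/a₁) ≥ 1. Let V : ℝ → ℝ be differentiable with V(t) ≥ 0 for all t ≥ 0 and V′(t) ≤ −a₁·V(t)^(1+1/μ) − a₂·V(t)^(1−1/μ) + a₃ for all t ≥ 0. Then for every t ≥ μ/(√(a₁·a₂)·(k − 1)), one has V(t) ≤ k^μ·(a₂/a₁)^(μ/2). (Lemma 1, case a₃ = 2√(a₁a₂): fixed-time convergence, uniform in the initial condition, to the set {V ≤ k^μ·(a₂/a₁)^(μ/2)}.) -/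
/-- If a differentiable function cannot increase while it lies above the level `M`, then lying
above `M` at time `t` forces it to lie above `M` at all earlier nonnegative times. -/
theorem lt_of_deriv_nonpos_of_lt {V : ℝ → ℝ} (hV : Differentiable ℝ V) {M t : ℝ}
    (hderiv : ∀ s, 0 ≤ s → M < V s → deriv V s ≤ 0) (ht : M < V t) :
    ∀ s ∈ Set.Icc 0 t, M < V s := by
  by_contra! hex
  obtain ⟨s, hs, hsM⟩ := hex
  have hcomp : IsCompact (Set.Icc 0 t ∩ V ⁻¹' Set.Iic M) :=
    isCompact_Icc.inter_right (isClosed_Iic.preimage hV.continuous)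
  obtain ⟨m, ⟨⟨hm0, hmt⟩, hmM⟩, hmax⟩ := hcomp.exists_isGreatest ⟨s, hs, hsM⟩
  have hanti : AntitoneOn V (Set.Icc m t) := by
    refine antitoneOn_of_deriv_nonpos (convex_Icc m t) hV.continuous.continuousOn
      hV.differentiableOn fun x hx => ?_
    rw [interior_Icc] at hx
    refine hderiv x (hm0.trans hx.1.le) ?_
    by_contra! hxM
    exact hx.1.not_ge (hmax ⟨⟨hm0.trans hx.1.le, hx.2.le⟩, hxM⟩)
  have hle := hanti ⟨le_rfl, hmt⟩ ⟨hmt, le_rfl⟩ hmt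
  exact ht.not_ge (hle.trans hmM)

/-- For `v ≥ 1`, the fixed-time vector field with critical constant term `2ar` is dominated by a
multiple of a perfect square. -/
theorem fixedTime_field_le {a r μ v : ℝ} (ha : 0 ≤ a) (hr : 0 ≤ r) (hv : 1 ≤ v) :
    -a * v ^ (1 + 1 / μ) - a * r ^ 2 * v ^ (1 - 1 / μ) + 2 * (a * r) ≤
      -(a * v ^ (1 - 1 / μ) * (v ^ (1 / μ) - r) ^ 2) := by
  have hv0 : 0 < v := by linarith
  have hmul : v ^ (1 - 1 / μ) * v ^ (1 / μ) = v := by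
    rw [← Real.rpow_add hv0, sub_add_cancel, Real.rpow_one]
  have hadd : v ^ (1 + 1 / μ) = v * v ^ (1 / μ) := by
    rw [Real.rpow_add hv0, Real.rpow_one]
  have hle : a * r ≤ a * r * v := le_mul_of_one_le_right (mul_nonneg ha hr) hv
  rw [hadd]
  linear_combination 2 * hle + a * (v ^ (1 / μ) - 2 * r) * hmul


/-- Lemma 1, case `a₃ = 2√(a₁a₂)`: fixed-time convergence, uniform in the initial
condition, to the set `{V ≤ k^μ·(a₂/a₁)^(μ/2)}` within time `μ/(√(a₁a₂)·(k−1))`. -/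
theorem stmt_6 (a₁ a₂ a₃ μ k : ℝ) (ha₁ : 0 < a₁) (ha₂ : 0 < a₂) (hμ : 1 < μ)
    (ha₃ : a₃ = 2 * Real.sqrt (a₁ * a₂)) (hk : 1 < k)
    (hk' : 1 ≤ k * Real.sqrt (a₂ / a₁))
    (V : ℝ → ℝ) (hV : Differentiable ℝ V)
    (hVnonneg : ∀ t, 0 ≤ t → 0 ≤ V t)
    (hVineq : ∀ t, 0 ≤ t →
      deriv V t ≤ -a₁ * V t ^ (1 + 1 / μ) - a₂ * V t ^ (1 - 1 / μ) + a₃) :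
    ∀ t, μ / (Real.sqrt (a₁ * a₂) * (k - 1)) ≤ t →
      V t ≤ k ^ μ * (a₂ / a₁) ^ (μ / 2) := by
  set r := Real.sqrt (a₂ / a₁) with hr_def
  have hr : 0 < r := Real.sqrt_pos.2 (div_pos ha₂ ha₁)
  have hr2 : r ^ 2 = a₂ / a₁ := Real.sq_sqrt (div_pos ha₂ ha₁).le
  have ha₂r : a₂ = a₁ * r ^ 2 := by rw [hr2]; field_simp
  have hsqrt : Real.sqrt (a₁ * a₂) = a₁ * r := by
    rw [ha₂r, show a₁ * (a₁ * r ^ 2) = (a₁ * r) ^ 2 by ring, Real.sqrt_sq (by positivity)]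
  have hμ0 : 0 < μ := by linarith
  have hk0 : 0 < k := by linarith
  have hM : k ^ μ * (a₂ / a₁) ^ (μ / 2) = (k * r) ^ μ := by
    rw [Real.mul_rpow hk0.le hr.le, ← hr2, ← Real.rpow_natCast_mul hr.le]
    congr 2
    push_cast
    ring
  rw [hsqrt, hM]
  intro t ht
  have hkr : r < k * r := lt_mul_of_one_lt_left hr hk
  have hM1 : 1 ≤ (k * r) ^ μ := Real.one_le_rpow hk' hμ0.le
  have hroot : ∀ {v : ℝ}, (k * r) ^ μ < v → k * r < v ^ (1 / μ) := fun {v} hv => by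
    have h := Real.rpow_lt_rpow (by positivity) hv (one_div_pos.2 hμ0)
    rwa [one_div, Real.rpow_rpow_inv (by positivity) hμ0.ne', ← one_div] at h
  have hsquare : ∀ s, 0 ≤ s → (k * r) ^ μ < V s →
      deriv V s ≤ -(a₁ * V s ^ (1 - 1 / μ) * (V s ^ (1 / μ) - r) ^ 2) := fun s hs hsM => by
    refine (hVineq s hs).trans ?_
    rw [ha₃, hsqrt, ha₂r]
    exact fixedTime_field_le ha₁.le hr.le (hM1.trans hsM.le)
  by_contra! htM
  have ht0 : 0 ≤ t := le_trans
    (div_nonneg hμ0.le (mul_nonneg (by positivity) (by linarith))) ht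
  have habove := lt_of_deriv_nonpos_of_lt hV (fun s hs hsM => by
    have hVs := hVnonneg s hs
    exact (hsquare s hs hsM).trans (neg_nonpos.2 (by positivity))) htM
  have hderiv : ∀ s ∈ Set.Icc 0 t, HasDerivAt (fun x => (V x ^ (1 / μ) - r)⁻¹)
      (-(deriv V s * (1 / μ) * V s ^ (1 / μ - 1)) / (V s ^ (1 / μ) - r) ^ 2) s := fun s hs => by
    have hsM := habove s hs
    have hVs : V s ≠ 0 := by linarith
    exact (((hV s).hasDerivAt.rpow_const (Or.inl hVs)).sub_const r).inv
      (sub_pos.2 (hkr.trans (hroot hsM))).ne'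
  have hgrowth : a₁ / μ * (t - 0) ≤ (V t ^ (1 / μ) - r)⁻¹ - (V 0 ^ (1 / μ) - r)⁻¹ := by
    refine (convex_Icc 0 t).mul_sub_le_image_sub_of_le_deriv
      (fun s hs => (hderiv s hs).continuousAt.continuousWithinAt)
      (fun s hs => (hderiv s (interior_subset hs)).differentiableAt.differentiableWithinAt)
      (fun s hs => ?_) 0 ⟨le_rfl, ht0⟩ t ⟨ht0, le_rfl⟩ ht0
    replace hs := interior_subset hs
    have hsM := habove s hs
    have hVs : 0 < V s := by linarith
    have hgap : 0 < V s ^ (1 / μ) - r := sub_pos.2 (hkr.trans (hroot hsM))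
    have hone : V s ^ (1 - 1 / μ) * V s ^ (1 / μ - 1) = 1 := by
      rw [← Real.rpow_add hVs, sub_add_sub_cancel, sub_self, Real.rpow_zero]
    rw [(hderiv s hs).deriv, le_div_iff₀ (by positivity)]
    have hmul := mul_le_mul_of_nonneg_right (hsquare s hs.1 hsM)
      (show 0 ≤ 1 / μ * V s ^ (1 / μ - 1) by positivity)
    linear_combination hmul - a₁ / μ * (V s ^ (1 / μ) - r) ^ 2 * hone
  have hgap0 : 0 < (V 0 ^ (1 / μ) - r)⁻¹ :=
    inv_pos.2 (sub_pos.2 (hkr.trans (hroot (habove 0 ⟨le_rfl, ht0⟩))))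
  have hgapt : (V t ^ (1 / μ) - r)⁻¹ < (k * r - r)⁻¹ :=
    inv_strictAnti₀ (sub_pos.2 hkr) (sub_lt_sub_right (hroot htM) r)
  have htime : (k * r - r)⁻¹ ≤ a₁ / μ * t := by
    have hk1 : 0 < k - 1 := sub_pos.2 hk
    calc (k * r - r)⁻¹ = a₁ / μ * (μ / (a₁ * r * (k - 1))) := by
          rw [show k * r - r = r * (k - 1) by ring]
          field_simp
      _ ≤ a₁ / μ * t := by gcongr
  linarith
end

section
/- Let α, β > 0, μ > 1, γ₁ = 1 + 1/μ, γ₂ = 1 − 1/μ, and t₀ ∈ ℝ. Let h : ℝ → ℝ be differentiable with h′(t) ≥ −α·sgn(h(t))·|h(t)|^γ₁ − β·sgn(h(t))·|h(t)|^γ₂ for all t ≥ t₀. If h(t₀) ≥ 0, then h(t) ≥ 0 for all t ≥ t₀. (Scalar form of the paper's Theorem: the time-varying fixed-time convergent control barrier function condition renders the zero-superlevel set forward invariant.) -/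
/-- Scalar form of the paper's Theorem: the time-varying fixed-time convergent
control barrier function condition renders the zero-superlevel set forward invariant. -/
theorem stmt_7 (α β μ γ₁ γ₂ t₀ : ℝ) (hα : 0 < α) (hβ : 0 < β) (hμ : 1 < μ)
    (hγ₁ : γ₁ = 1 + 1 / μ) (hγ₂ : γ₂ = 1 - 1 / μ)
    (h : ℝ → ℝ) (hdiff : Differentiable ℝ h)
    (hineq : ∀ t, t₀ ≤ t →
      -α * Real.sign (h t) * |h t| ^ γ₁ - β * Real.sign (h t) * |h t| ^ γ₂ ≤
        deriv h t)
    (h₀ : 0 ≤ h t₀) :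
    ∀ t, t₀ ≤ t → 0 ≤ h t := by
  intro t ht
  refine le_of_forall_pos_le_add fun ε hε => ?_
  have key := image_le_of_deriv_right_lt_deriv_boundary (f := fun x => -h x)
    (f' := fun x => -deriv h x) (a := t₀) (b := t) (B := fun _ => ε) (B' := fun _ => 0)
    hdiff.neg.continuous.continuousOn
    (fun x _ => (hdiff x).hasDerivAt.neg.hasDerivWithinAt)
    (by linarith) (fun x => hasDerivAt_const x ε)
    (fun x hx hxε => by
      have hneg : h x < 0 := by linarith
      have hbound := hineq x hx.1
      rw [Real.sign_of_neg hneg] at hbound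
      have habs : 0 < |h x| := abs_pos.mpr hneg.ne
      have h1 := mul_pos hα (Real.rpow_pos_of_pos habs γ₁)
      have h2 := mul_pos hβ (Real.rpow_pos_of_pos habs γ₂)
      linarith)
    ⟨ht, le_rfl⟩
  linarith
end

section
/- Let α, β > 0, μ > 1, γ₁ = 1 + 1/μ, γ₂ = 1 − 1/μ, δ ≥ 0, and t₀ ∈ ℝ. Let h : ℝ → ℝ be differentiable with h′(t) ≥ −δ − α·sgn(h(t))·|h(t)|^γ₁ − β·sgn(h(t))·|h(t)|^γ₂ for all t ≥ t₀. If h(t₀) ≥ −δ/(2·√(α·β)), then h(t) ≥ −δ/(2·√(α·β)) for all t ≥ t₀. (Forward invariance of the relaxed set C_rf = {h ≥ −ε_max} with ε_max = δ/(2√(αβ)); part of Proposition 1.) -/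
/-- If the derivative of `f` is positive wherever `f` is below the level `c` on `[a, ∞)`, then
`f` cannot cross the level `c` downwards after time `a`. -/
theorem le_of_deriv_pos_below {f : ℝ → ℝ} (hf : Differentiable ℝ f) {a c : ℝ}
    (hpos : ∀ t, a ≤ t → f t < c → 0 < deriv f t) (ha : c ≤ f a) {t : ℝ} (ht : a ≤ t) :
    c ≤ f t := by
  refine le_of_forall_pos_le_add fun η hη => ?_
  have key := image_le_of_deriv_right_lt_deriv_boundary (f := fun s => -f s)
    (f' := fun s => -deriv f s) (a := a) (b := t) (B := fun _ => -c + η) (B' := fun _ => 0)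
    hf.continuous.neg.continuousOn
    (fun s _ => (hf s).hasDerivAt.neg.hasDerivWithinAt)
    (by linarith) (fun s => hasDerivAt_const s _)
    (fun s hs hs' => by
      have := hpos s hs.1 (by linarith)
      linarith)
    (Set.right_mem_Icc.mpr ht)
  linarith

/-- The AM-GM inequality for two powers whose exponents average to one. -/
theorem two_sqrt_mul_le_rpow_add_rpow {α β v : ℝ} (hα : 0 ≤ α) (hβ : 0 ≤ β) (hv : 0 < v) (p : ℝ) :
    2 * √(α * β) * v ≤ α * v ^ (1 + p) + β * v ^ (1 - p) := by
  have hprod : v ^ (1 + p) * v ^ (1 - p) = v ^ 2 := by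
    rw [← Real.rpow_add hv, ← Real.rpow_natCast]
    congr 1
    push_cast
    ring
  have hx : 0 ≤ α * v ^ (1 + p) := by positivity
  have hy : 0 ≤ β * v ^ (1 - p) := by positivity
  refine (sq_le_sq₀ (by positivity) (add_nonneg hx hy)).mp ?_
  have hsq : (2 * √(α * β) * v) ^ 2 = 4 * ((α * v ^ (1 + p)) * (β * v ^ (1 - p))) := by
    rw [mul_pow, mul_pow, Real.sq_sqrt (mul_nonneg hα hβ), ← hprod]
    ring
  rw [hsq]
  nlinarith [sq_nonneg (α * v ^ (1 + p) - β * v ^ (1 - p))]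

/-- Proposition 1 (forward-invariance part): the relaxed set
`C_rf = {h ≥ −δ/(2√(αβ))}` is forward invariant under the robust barrier condition. -/
theorem stmt_8 (α β μ γ₁ γ₂ δ t₀ : ℝ) (hα : 0 < α) (hβ : 0 < β) (hμ : 1 < μ)
    (hγ₁ : γ₁ = 1 + 1 / μ) (hγ₂ : γ₂ = 1 - 1 / μ) (hδ : 0 ≤ δ)
    (h : ℝ → ℝ) (hdiff : Differentiable ℝ h)
    (hineq : ∀ t, t₀ ≤ t →
      -δ - α * Real.sign (h t) * |h t| ^ γ₁ - β * Real.sign (h t) * |h t| ^ γ₂ ≤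
        deriv h t)
    (h₀ : -δ / (2 * Real.sqrt (α * β)) ≤ h t₀) :
    ∀ t, t₀ ≤ t → -δ / (2 * Real.sqrt (α * β)) ≤ h t := by
  intro t ht
  refine le_of_deriv_pos_below hdiff (fun s hs hlt => ?_) h₀ ht
  have hD : 0 < 2 * √(α * β) := by positivity
  have hneg : h s < 0 :=
    hlt.trans_le (div_nonpos_of_nonpos_of_nonneg (neg_nonpos.mpr hδ) hD.le)
  have hgap : δ < 2 * √(α * β) * -h s := by
    have := (lt_div_iff₀ hD).mp hlt
    linarith
  have hamgm := two_sqrt_mul_le_rpow_add_rpow hα.le hβ.le (neg_pos.mpr hneg) (1 / μ)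
  have hderiv := hineq s hs
  rw [Real.sign_of_neg hneg, abs_of_neg hneg, hγ₁, hγ₂] at hderiv
  linarith
end

section
/- Let α, β > 0, μ > 1, γ₁ = 1 + 1/μ, γ₂ = 1 − 1/μ, and 0 ≤ δ < 2·√(α·β). Set k₁ = √(4·α·β − δ²)/(2·α) and k₂ = −δ/√(4·α·β − δ²). Let h : ℝ → ℝ be differentiable with h′(t) ≥ −δ − α·sgn(h(t))·|h(t)|^γ₁ − β·sgn(h(t))·|h(t)|^γ₂ for all t ≥ t₀. Then h(t) ≥ −1 for every t ≥ t₀ + (μ/(α·k₁))·(π/2 − arctan(k₂)), regardless of the value of h(t₀). (Fixed-time reach of a neighborhood of the relaxed set C_rf with convergence time independent of the initial condition; Proposition 1, case 0 ≤ δ < 2√(αβ).) -/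
/-- A superlevel set `{h ≥ -1}` is forward invariant if `h` increases whenever it equals `-1`. -/
lemma neg_one_le_of_deriv_pos {h : ℝ → ℝ} (hdiff : Differentiable ℝ h) {s T : ℝ} (hsT : s ≤ T)
    (hpos : ∀ t, s ≤ t → h t = -1 → 0 < deriv h t) (hs : -1 ≤ h s) : -1 ≤ h T := by
  have key := image_le_of_deriv_right_lt_deriv_boundary (f := fun t => -h t)
    (f' := fun t => -deriv h t) (a := s) (b := T) (B := fun _ => 1) (B' := fun _ => 0)
    hdiff.continuous.neg.continuousOn
    (fun x _ => (hdiff x).hasDerivAt.neg.hasDerivWithinAt) (by linarith)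
    (fun x => hasDerivAt_const x 1)
    (fun x hx hx1 => by
      have := hpos x hx.1 (by linarith)
      linarith)
    (Set.right_mem_Icc.2 hsT)
  linarith

/-- Where `h < -1`, the arctangent of the normalized power of `-h` decreases at a uniform rate. -/
lemma exists_hasDerivAt_arctan_rpow_le {α β μ δ k : ℝ} (hα : 0 < α) (hμ : 1 < μ) (hδ : 0 ≤ δ)
    (hk : 0 < k) (hk_sq : α * k ^ 2 + δ ^ 2 / (4 * α) = β)
    {h : ℝ → ℝ} {t : ℝ} (hdiff : DifferentiableAt ℝ h t) (ht : h t < -1)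
    (hineq : -δ + α * (-h t) ^ (1 + 1 / μ) + β * (-h t) ^ (1 - 1 / μ) ≤ deriv h t) :
    ∃ d, HasDerivAt (fun s => Real.arctan (((-h s) ^ (1 / μ) - δ / (2 * α)) / k)) d t ∧
      d ≤ -(α * k / μ) := by
  have hμ0 : 0 < μ := by linarith
  have hw : 0 < -h t := by linarith
  have hv := Real.rpow_pos_of_pos hw (1 / μ)
  have hder := ((((hdiff.hasDerivAt.neg.rpow_const (p := 1 / μ)
    (Or.inl hw.ne')).sub_const (δ / (2 * α))).div_const k).arctan)
  refine ⟨_, hder, ?_⟩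
  simp only [Pi.neg_apply]
  rw [Real.rpow_sub hw, Real.rpow_one]
  rw [Real.rpow_add hw, Real.rpow_sub hw, Real.rpow_one] at hineq
  generalize (-h t) ^ (1 / μ) = v at *
  have hw1 : 1 < -h t := by linarith
  generalize -h t = w at *
  have hvw : -deriv h t * (v / w) ≤ -(α * (k ^ 2 + (v - δ / (2 * α)) ^ 2)) := by
    have h1 : -deriv h t * (v / w) ≤ (δ - α * (w * v) - β * (w / v)) * (v / w) :=
      mul_le_mul_of_nonneg_right (by linarith) (by positivity)
    have h2 : (δ - α * (w * v) - β * (w / v)) * (v / w) = δ * (v / w) - α * v ^ 2 - β := by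
      field_simp
    have h3 : δ * (v / w) ≤ δ * v :=
      mul_le_mul_of_nonneg_left (div_le_self hv.le hw1.le) hδ
    have h4 : α * (k ^ 2 + (v - δ / (2 * α)) ^ 2) = α * v ^ 2 - δ * v + β := by
      rw [← hk_sq]
      field_simp
      ring
    linarith
  have hD : 0 < k ^ 2 + (v - δ / (2 * α)) ^ 2 := by positivity
  generalize v - δ / (2 * α) = u at *
  have hrw : 1 / (1 + (u / k) ^ 2) * (-deriv h t * (1 / μ) * (v / w) / k) =
      (k / (μ * (k ^ 2 + u ^ 2))) * (-deriv h t * (v / w)) := by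
    field_simp
  have hrhs : -(α * k / μ) = (k / (μ * (k ^ 2 + u ^ 2))) * -(α * (k ^ 2 + u ^ 2)) := by
    field_simp
  rw [hrw, hrhs]
  exact mul_le_mul_of_nonneg_left hvw (by positivity)

/-- Proposition 1, case `0 ≤ δ < 2√(αβ)`: fixed-time reach of a neighborhood of the
relaxed set `C_rf`, with convergence time independent of the initial condition. -/
theorem stmt_9 (α β μ γ₁ γ₂ δ k₁ k₂ t₀ : ℝ) (hα : 0 < α) (hβ : 0 < β) (hμ : 1 < μ)
    (hγ₁ : γ₁ = 1 + 1 / μ) (hγ₂ : γ₂ = 1 - 1 / μ)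
    (hδ0 : 0 ≤ δ) (hδ : δ < 2 * Real.sqrt (α * β))
    (hk₁ : k₁ = Real.sqrt (4 * α * β - δ ^ 2) / (2 * α))
    (hk₂ : k₂ = -δ / Real.sqrt (4 * α * β - δ ^ 2))
    (h : ℝ → ℝ) (hdiff : Differentiable ℝ h)
    (hineq : ∀ t, t₀ ≤ t →
      -δ - α * Real.sign (h t) * |h t| ^ γ₁ - β * Real.sign (h t) * |h t| ^ γ₂ ≤
        deriv h t) :
    ∀ t, t₀ + (μ / (α * k₁)) * (Real.pi / 2 - Real.arctan k₂) ≤ t →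
      -1 ≤ h t := by
  intro T hT
  have hμ0 : 0 < μ := by linarith
  have hsq := Real.sq_sqrt (mul_pos hα hβ).le
  have hdisc : 0 < 4 * α * β - δ ^ 2 := by nlinarith
  have hr := Real.sqrt_pos.2 hdisc
  have hr_sq := Real.sq_sqrt hdisc.le
  generalize Real.sqrt (4 * α * β - δ ^ 2) = r at *
  have hk : 0 < k₁ := by rw [hk₁]; positivity
  have hk_sq : α * k₁ ^ 2 + δ ^ 2 / (4 * α) = β := by
    rw [hk₁]
    field_simp
    linarith
  have hk₂' : k₂ = (0 - δ / (2 * α)) / k₁ := by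
    rw [hk₂, hk₁]
    field_simp
    ring
  have hδ_lt : δ < α + β := by nlinarith [sq_nonneg (α - β)]
  have hineq' : ∀ t, t₀ ≤ t → h t < 0 →
      -δ + α * (-h t) ^ (1 + 1 / μ) + β * (-h t) ^ (1 - 1 / μ) ≤ deriv h t := by
    intro t ht hneg
    have := hineq t ht
    rw [Real.sign_of_neg hneg, abs_of_neg hneg, hγ₁, hγ₂] at this
    linarith
  have hpos : ∀ t, t₀ ≤ t → h t = -1 → 0 < deriv h t := by
    intro t ht h1
    have := hineq' t ht (by linarith)
    rw [h1, neg_neg, Real.one_rpow, Real.one_rpow] at this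
    linarith
  have harc := Real.arctan_lt_pi_div_two k₂
  have hT₀ : t₀ ≤ T := by
    have : 0 ≤ μ / (α * k₁) * (Real.pi / 2 - Real.arctan k₂) :=
      mul_nonneg (by positivity) (by linarith)
    linarith
  by_contra! hlt
  have hbelow : ∀ t ∈ Set.Icc t₀ T, h t < -1 := by
    intro t ht
    by_contra! hge
    exact hlt.not_ge
      (neg_one_le_of_deriv_pos hdiff ht.2 (fun s hs => hpos s (ht.1.trans hs)) hge)
  have hder : ∀ t ∈ Set.Icc t₀ T, _ := fun t ht =>
    exists_hasDerivAt_arctan_rpow_le hα hμ hδ0 hk hk_sq (hdiff t) (hbelow t ht)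
      (hineq' t ht.1 (by linarith [hbelow t ht]))
  have hdecay := (convex_Icc t₀ T).image_sub_le_mul_sub_of_deriv_le
    (f := fun s => Real.arctan (((-h s) ^ (1 / μ) - δ / (2 * α)) / k₁)) (C := -(α * k₁ / μ))
    (fun t ht => by
      obtain ⟨d, hd, -⟩ := hder t ht
      exact hd.continuousAt.continuousWithinAt)
    (fun t ht => by
      obtain ⟨d, hd, -⟩ := hder t (interior_subset ht)
      exact hd.differentiableAt.differentiableWithinAt)
    (fun t ht => by
      obtain ⟨d, hd, hle⟩ := hder t (interior_subset ht)
      exact hd.deriv.trans_le hle)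
    t₀ (Set.left_mem_Icc.2 hT₀) T (Set.right_mem_Icc.2 hT₀) hT₀
  have hstart := Real.arctan_lt_pi_div_two (((-h t₀) ^ (1 / μ) - δ / (2 * α)) / k₁)
  have hend : Real.arctan k₂ < Real.arctan (((-h T) ^ (1 / μ) - δ / (2 * α)) / k₁) := by
    have := Real.rpow_pos_of_pos (show 0 < -h T by linarith) (1 / μ)
    rw [hk₂']
    exact Real.arctan_strictMono (by gcongr)
  have htime : Real.pi / 2 - Real.arctan k₂ ≤ α * k₁ / μ * (T - t₀) := by
    calc Real.pi / 2 - Real.arctan k₂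
        = α * k₁ / μ * (μ / (α * k₁) * (Real.pi / 2 - Real.arctan k₂)) := by field_simp
      _ ≤ α * k₁ / μ * (T - t₀) :=
          mul_le_mul_of_nonneg_left (by linarith) (by positivity)
  linarith
end
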